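/- arXiv:1511.01315 — 2 statements merged into one kernel-verified Lean document; each statement's English description precedes it below -/
import Mathlib

section
/- Fix positive integers d and λ with λ−1 < ⌈d/2⌉. Define the sets I(d,λ,j) ⊆ {1,…,d−λ+2} as follows. For odd d, set I(d,λ) = {1,2,…,λ−1} ∪ {λ, λ+2, λ+4, …, d−λ+1}, let σ be the cyclic permutation of {1,…,d−λ+2} with σ(i) = i+1 for i ≤ d−λ+1 and σ(d−λ+2) = 1, and define I(d,λ,j) = σ^{j−1}(I(d,λ)) for j ∈ {1,…,d−λ+2}. For even d and j ∈ {1,…,d−λ+1}, define I(d,λ,j) = I(d−1,λ,j) ∪ {d−λ+2} if 1 ∈ I(d−1,λ,j), and I(d,λ,j) = I(d−1,λ,j) otherwise. (In both cases there are 2⌈d/2⌉−λ+1 sets.) Then: (1) each number of {1,…,d−λ+2} appears in exactly ⌈d/2⌉ of the sets I(d,λ,j); and (2) OD(I(d,λ,j)) ≤ λ−1 for each j. -/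
open Finset

noncomputable section

/-- `OD S` is the number of odd integers among the consecutive differences of the
increasingly-ordered elements of the finite set `S` of naturals. -/
def OD (S : Finset ℕ) : ℕ :=
  (((S.sort (· ≤ ·)).zip (S.sort (· ≤ ·)).tail).filter
    (fun p => (p.2 - p.1) % 2 = 1)).length

/-- For odd `d`: the base set `I(d,λ) = {1,…,λ-1} ∪ {λ, λ+2, …, d-λ+1}`. -/
def IBase (d lam : ℕ) : Finset ℕ :=
  Finset.Icc 1 (lam - 1) ∪ (Finset.Icc lam (d - lam + 1)).filter (fun x => x % 2 = lam % 2)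

/-- The cyclic permutation `σ` of `{1,…,N}`: `σ(i) = i+1` for `i ≤ N-1`, `σ(N) = 1`. -/
def cycShift (N i : ℕ) : ℕ := if i = N then 1 else i + 1

/-- For odd `d`: `I(d,λ,j) = σ^{j-1}(I(d,λ))` with `σ` the cyclic permutation of
`{1,…,d-λ+2}`. -/
def IOdd (d lam j : ℕ) : Finset ℕ :=
  (IBase d lam).image ((cycShift (d - lam + 2))^[j - 1])

/-- `I(d,λ,j)` for both parities of `d`: for even `d` and `j ∈ {1,…,d-λ+1}`, it is
`I(d-1,λ,j) ∪ {d-λ+2}` when `1 ∈ I(d-1,λ,j)`, and `I(d-1,λ,j)` otherwise. -/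
def ISet (d lam j : ℕ) : Finset ℕ :=
  if d % 2 = 1 then IOdd d lam j
  else if 1 ∈ IOdd (d - 1) lam j then IOdd (d - 1) lam j ∪ {d - lam + 2}
  else IOdd (d - 1) lam j

theorem List.map_fst_zip_sublist {α β : Type*} (l : List α) (l' : List β) :
    ((l.zip l').map Prod.fst).Sublist l := by
  induction l generalizing l' with
  | nil => simp
  | cons a l ih =>
    cases l' with
    | nil => simp
    | cons b l' => simpa using ih l'

/-- `OD S` is at most the size of any set containing every element of `S` whose successor in `S`
has the opposite parity. -/
theorem OD_le_card {S T : Finset ℕ}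
    (h : ∀ a ∈ S, ∀ b ∈ S, a < b → (∀ c ∈ S, c ≤ a ∨ b ≤ c) → (b - a) % 2 = 1 → a ∈ T) :
    OD S ≤ T.card := by
  unfold OD
  set l := S.sort (· ≤ ·) with hl
  have hsorted : l.SortedLT := S.sortedLT_sort
  have hnodup : (((l.zip l.tail).filter (fun p => (p.2 - p.1) % 2 = 1)).map Prod.fst).Nodup :=
    ((List.filter_sublist.map _).trans (List.map_fst_zip_sublist _ _)).nodup hsorted.nodup
  rw [← List.length_map (f := Prod.fst), ← List.toFinset_card_of_nodup hnodup]
  refine Finset.card_le_card fun a ha => ?_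
  simp only [List.mem_toFinset, List.mem_map, List.mem_filter, decide_eq_true_eq] at ha
  obtain ⟨⟨a, b⟩, ⟨hmem, hodd⟩, rfl⟩ := ha
  obtain ⟨k, hk, hkab⟩ := List.getElem_of_mem hmem
  simp only [List.length_zip, List.length_tail] at hk
  simp only [List.getElem_zip, List.getElem_tail, Prod.mk.injEq] at hkab
  obtain ⟨rfl, rfl⟩ := hkab
  have hmono := hsorted.strictMono_get
  refine h _ ((Finset.mem_sort _).1 (List.getElem_mem _)) _
    ((Finset.mem_sort _).1 (List.getElem_mem _)) ?_ (fun c hc => ?_) hodd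
  · exact hmono (a := ⟨k, by omega⟩) (b := ⟨k + 1, by omega⟩) (by simp)
  · obtain ⟨n, hn, rfl⟩ := List.getElem_of_mem ((Finset.mem_sort (· ≤ ·)).2 hc)
    rcases Nat.lt_or_ge k n with hkn | hkn
    · exact Or.inr (hmono.monotone (a := ⟨k + 1, by omega⟩) (b := ⟨n, hn⟩) hkn)
    · exact Or.inl (hmono.monotone (a := ⟨n, hn⟩) (b := ⟨k, by omega⟩) hkn)

theorem iterate_cycShift {N x t : ℕ} (hxN : x ≤ N) (ht : t ≤ N) :
    (cycShift N)^[t] x = if x + t ≤ N then x + t else x + t - N := by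
  induction t with
  | zero => simp [hxN]
  | succ t ih =>
    rw [Function.iterate_succ_apply', ih (by omega), cycShift]
    split_ifs <;> omega

theorem mem_IBase {d lam x : ℕ} :
    x ∈ IBase d lam ↔
      1 ≤ x ∧ x ≤ lam - 1 ∨ (lam ≤ x ∧ x ≤ d - lam + 1) ∧ x % 2 = lam % 2 := by
  simp [IBase]

theorem card_IBase {d lam : ℕ} (hd : d % 2 = 1) (hlam : 1 ≤ lam) (h : 2 * lam ≤ d + 1) :
    (IBase d lam).card = (d + 1) / 2 := by
  have himage : (Finset.Icc lam (d - lam + 1)).filter (fun x => x % 2 = lam % 2) =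
      (Finset.range ((d + 1) / 2 - lam + 1)).image (fun k => lam + 2 * k) := by
    ext x
    simp only [Finset.mem_filter, Finset.mem_Icc, Finset.mem_image, Finset.mem_range]
    constructor
    · rintro ⟨hx, hpar⟩
      exact ⟨(x - lam) / 2, by omega, by omega⟩
    · rintro ⟨k, hk, rfl⟩
      omega
  rw [IBase, Finset.card_union_of_disjoint, himage, Finset.card_image_of_injective,
    Nat.card_Icc, Finset.card_range]
  · omega
  · intro a b hab
    simpa using hab
  · rw [Finset.disjoint_left]
    intro x hx hx'
    simp only [Finset.mem_filter, Finset.mem_Icc] at hx hx'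
    omega

/-- The position in `{1,…,N}` that `σ^{j-1}` moves to `i`. -/
def cycPreimage (N i j : ℕ) : ℕ := if j ≤ i then i - j + 1 else i + N - j + 1

theorem mem_IOdd {d lam j i : ℕ} (hlam : 1 ≤ lam) (h : 2 * lam ≤ d + 1)
    (hj : 1 ≤ j) (hjN : j ≤ d - lam + 2) :
    i ∈ IOdd d lam j ↔
      (1 ≤ i ∧ i ≤ d - lam + 2) ∧ cycPreimage (d - lam + 2) i j ∈ IBase d lam := by
  have hbase : ∀ x ∈ IBase d lam, 1 ≤ x ∧ x ≤ d - lam + 2 := by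
    intro x hx
    rw [mem_IBase] at hx
    omega
  rw [IOdd, Finset.mem_image]
  constructor
  · rintro ⟨x, hx, rfl⟩
    have hxN := hbase x hx
    rw [iterate_cycShift hxN.2 (by omega)]
    refine ⟨by split_ifs <;> omega, ?_⟩
    convert hx using 1
    unfold cycPreimage
    split_ifs <;> omega
  · rintro ⟨hi, hmem⟩
    refine ⟨_, hmem, ?_⟩
    have hxN := hbase _ hmem
    rw [iterate_cycShift hxN.2 (by omega)]
    unfold cycPreimage
    split_ifs <;> omega

theorem card_filter_mem_IOdd {d lam i : ℕ} (hd : d % 2 = 1) (hlam : 1 ≤ lam)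
    (h : 2 * lam ≤ d + 1) (hi : 1 ≤ i) (hiN : i ≤ d - lam + 2) :
    ((Finset.Icc 1 (d - lam + 2)).filter (fun j => i ∈ IOdd d lam j)).card = (d + 1) / 2 := by
  rw [← card_IBase hd hlam h]
  have hinvol : ∀ j, 1 ≤ j → j ≤ d - lam + 2 →
      cycPreimage (d - lam + 2) i (cycPreimage (d - lam + 2) i j) = j := by
    intro j hj hjN
    unfold cycPreimage
    split_ifs <;> omega
  have hbase : ∀ x ∈ IBase d lam, 1 ≤ x ∧ x ≤ d - lam + 2 := by
    intro x hx
    rw [mem_IBase] at hx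
    omega
  refine Finset.card_nbij' (cycPreimage (d - lam + 2) i) (cycPreimage (d - lam + 2) i) ?_ ?_ ?_ ?_
  · intro j hj
    simp only [Finset.coe_filter, Finset.mem_Icc, Set.mem_ofPred_eq] at hj
    exact ((mem_IOdd hlam h hj.1.1 hj.1.2).1 hj.2).2
  · intro x hx
    have hxN := hbase x hx
    have hj : 1 ≤ cycPreimage (d - lam + 2) i x ∧
        cycPreimage (d - lam + 2) i x ≤ d - lam + 2 := by
      unfold cycPreimage
      split_ifs <;> omega
    simp only [Finset.coe_filter, Finset.mem_Icc, Set.mem_ofPred_eq]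
    refine ⟨hj, (mem_IOdd hlam h hj.1 hj.2).2 ⟨⟨hi, hiN⟩, ?_⟩⟩
    rwa [hinvol x hxN.1 hxN.2]
  · intro j hj
    simp only [Finset.coe_filter, Finset.mem_Icc, Set.mem_ofPred_eq] at hj
    exact hinvol j hj.1.1 hj.1.2
  · intro x hx
    exact hinvol x (hbase x hx).1 (hbase x hx).2

/-- Cutting the cycle open, with or without a repeated copy `N + 1` of the point `1`, leaves at
most the `λ - 1` odd gaps that follow the images of `1, …, λ - 1`. -/
theorem OD_le_of_mem_iff_IOdd {d lam j : ℕ} {S : Finset ℕ} (hd : d % 2 = 1) (hlam : 1 ≤ lam)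
    (h : 2 * lam ≤ d + 1) (hj : 1 ≤ j) (hjN : j ≤ d - lam + 2)
    (hS : ∀ i ≤ d - lam + 2, i ∈ S ↔ i ∈ IOdd d lam j)
    (hle : ∀ i ∈ S, i ≤ d - lam + 3)
    (hlast : d - lam + 3 ∈ S → 1 ∈ IOdd d lam j) :
    OD S ≤ lam - 1 := by
  have hcard : ((Finset.Icc 1 (lam - 1)).image ((cycShift (d - lam + 2))^[j - 1])).card ≤
      lam - 1 := by
    simpa using Finset.card_image_le (s := Finset.Icc 1 (lam - 1))
      (f := (cycShift (d - lam + 2))^[j - 1])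
  refine (OD_le_card fun a ha b hb hab hgap hodd => ?_).trans hcard
  have haN : a ≤ d - lam + 2 := by have := hle b hb; omega
  have ha' := (hS a haN).1 ha
  obtain ⟨x, hx, rfl⟩ := Finset.mem_image.1 ha'
  by_cases hxl : x ≤ lam - 1
  · rw [mem_IBase] at hx
    exact Finset.mem_image_of_mem _ (Finset.mem_Icc.2 (by omega))
  exfalso
  have hbase := mem_IBase.1 hx
  rw [iterate_cycShift (by omega) (by omega)] at ha ha' hab hgap hodd haN
  set a := if x + (j - 1) ≤ d - lam + 2 then x + (j - 1) else x + (j - 1) - (d - lam + 2)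
    with ha_def
  have hsucc : a + 1 ∉ S := by
    intro hmem
    have hmem' : (if a + 1 ≤ d - lam + 2 then a + 1 else 1) ∈ IOdd d lam j := by
      split_ifs with hc
      · exact (hS _ hc).1 hmem
      · exact hlast (by rwa [show d - lam + 3 = a + 1 by omega])
    rw [mem_IOdd hlam h hj hjN, mem_IBase, cycPreimage] at hmem'
    split_ifs at hmem' ha_def <;> omega
  have hsucc' : a + 2 ≤ d - lam + 2 → a + 2 ∈ S := by
    intro hc
    rw [hS _ hc, mem_IOdd hlam h hj hjN, mem_IBase, cycPreimage]
    split_ifs at ha_def ⊢ <;> omega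
  have hb1 : b ≠ a + 1 := by rintro rfl; exact hsucc hb
  have hbN := hle b hb
  by_cases hc : a + 2 ≤ d - lam + 2
  · have := hgap _ (hsucc' hc)
    omega
  · omega

/-- for positive `d`, `λ` with `λ - 1 < ⌈d/2⌉`, among the
`2⌈d/2⌉ - λ + 1` sets `I(d,λ,j)`:
(1) each number of `{1,…,d-λ+2}` appears in exactly `⌈d/2⌉` of them, and
(2) each satisfies `OD(I(d,λ,j)) ≤ λ - 1`.
(Here `⌈d/2⌉ = (d+1)/2` as naturals.) -/
theorem ISet_properties (d lam : ℕ) (hd : 1 ≤ d) (hlam : 1 ≤ lam)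
    (hrange : lam - 1 < (d + 1) / 2) :
    (∀ i ∈ Finset.Icc 1 (d - lam + 2),
      ((Finset.Icc 1 (2 * ((d + 1) / 2) - lam + 1)).filter
        (fun j => i ∈ ISet d lam j)).card = (d + 1) / 2) ∧
    (∀ j ∈ Finset.Icc 1 (2 * ((d + 1) / 2) - lam + 1), OD (ISet d lam j) ≤ lam - 1) := by
  by_cases hodd : d % 2 = 1
  · have hI : ∀ j, ISet d lam j = IOdd d lam j := fun j => by rw [ISet, if_pos hodd]
    have hN : 2 * ((d + 1) / 2) - lam + 1 = d - lam + 2 := by omega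
    simp only [hI, hN, Finset.mem_Icc]
    refine ⟨fun i hi => card_filter_mem_IOdd hodd hlam (by omega) hi.1 hi.2, fun j hj => ?_⟩
    have hle : ∀ i ∈ IOdd d lam j, i ≤ d - lam + 2 := fun i hi =>
      ((mem_IOdd hlam (by omega) hj.1 hj.2).1 hi).1.2
    refine OD_le_of_mem_iff_IOdd hodd hlam (by omega) hj.1 hj.2 (fun i _ => Iff.rfl)
      (fun i hi => (hle i hi).trans (by omega)) fun hmem => ?_
    have := hle _ hmem
    omega
  · have hI : ∀ j i, i ∈ ISet d lam j ↔
        i ∈ IOdd (d - 1) lam j ∨ i = d - lam + 2 ∧ 1 ∈ IOdd (d - 1) lam j := by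
      intro j i
      rw [ISet, if_neg hodd]
      split_ifs with h1 <;> simp [h1, or_comm]
    have hN : 2 * ((d + 1) / 2) - lam + 1 = d - 1 - lam + 2 := by omega
    have hlt : ∀ j, 1 ≤ j → j ≤ d - 1 - lam + 2 → ∀ i ∈ IOdd (d - 1) lam j,
        i ≤ d - 1 - lam + 2 := fun j hj hjN i hi =>
      ((mem_IOdd hlam (by omega) hj hjN).1 hi).1.2
    rw [hN]
    constructor
    · intro i hi
      rw [Finset.mem_Icc] at hi
      have key : ∃ i', (1 ≤ i' ∧ i' ≤ d - 1 - lam + 2) ∧ ∀ j, 1 ≤ j → j ≤ d - 1 - lam + 2 →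
          (i ∈ ISet d lam j ↔ i' ∈ IOdd (d - 1) lam j) := by
        by_cases hilast : i = d - lam + 2
        · refine ⟨1, by omega, fun j hj hjN => ?_⟩
          have hnot : i ∉ IOdd (d - 1) lam j := fun hmem => by
            have := hlt j hj hjN i hmem
            omega
          simp [hI, hnot, hilast.symm]
        · exact ⟨i, by omega, fun j _ _ => by simp [hI, hilast]⟩
      obtain ⟨i', hi', hiff⟩ := key
      rw [Finset.filter_congr fun j hj =>
          hiff j (Finset.mem_Icc.1 hj).1 (Finset.mem_Icc.1 hj).2,
        card_filter_mem_IOdd (by omega) hlam (by omega) hi'.1 hi'.2]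
      omega
    · intro j hj
      rw [Finset.mem_Icc] at hj
      refine OD_le_of_mem_iff_IOdd (d := d - 1) (j := j) (by omega) hlam (by omega) hj.1 hj.2
        (fun i hi => ?_) (fun i hi => ?_) fun hmem => ?_
      · rw [hI, or_iff_left]
        omega
      · rcases (hI j i).1 hi with hi | hi
        · exact (hlt j hj.1 hj.2 i hi).trans (by omega)
        · omega
      · rcases (hI j _).1 hmem with hmem | hmem
        · have := hlt j hj.1 hj.2 _ hmem
          omega
        · exact hmem.2
end
end

section
/- Let k, d, λ ≥ 1 be integers with d ≥ λ. Let t₁ < t₂ < … < t_n be reals and v_i = γ(t_i) ∈ ℝ^d for i = 1,…,n, and set V = {v₁,…,v_n}. Fix indices 1 ≤ i₁ < i₂ < … < i_{d−λ+1} ≤ n and let T = {v_{i₁},…,v_{i_{d−λ+1}}}. Define A₁ = {v₁,…,v_{i₁−1}}, A_j = {v_i : i_{j−1} < i < i_j} for j ∈ {2,…,d−λ+1}, and A_{d−λ+2} = {v_{i_{d−λ+1}+1},…,v_n}. If the affine hull of T intersects the convex hull of every k-element subset of V, then for every subset S ⊆ {1,…,d−λ+2} with OD(S) ≤ λ−1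 we have Σ_{α∈S} |A_α| ≤ k−1. -/
open Finset

noncomputable section

/-- Points of `ℝ^d`. -/
abbrev Pt (d : ℕ) : Type := Fin d → ℝ

/-- The moment curve `γ(t) = (t, t², …, t^d)` in `ℝ^d`. -/
def momentCurve (d : ℕ) (t : ℝ) : Pt d := fun i => t ^ ((i : ℕ) + 1)

/-- The vertex set `{γ(t₁), …, γ(t_n)}` of a cyclic polytope. -/
def cyclicVerts (d n : ℕ) (t : Fin n → ℝ) : Finset (Pt d) :=
  Finset.image (fun i => momentCurve d (t i)) Finset.univ

/-- The 1-based position of the `j`-th chosen index (for `1 ≤ j ≤ m`), with the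
conventions `pos 0 = 0` and `pos j = n+1` for `j > m`. -/
def posFun (n m : ℕ) (ι : Fin m → Fin n) (j : ℕ) : ℕ :=
  if h : 1 ≤ j ∧ j ≤ m then ((ι ⟨j - 1, by omega⟩ : Fin n) : ℕ) + 1
  else if j = 0 then 0 else n + 1

/-- The set of indices lying strictly between the `(j-1)`-st and the `j`-th chosen
indices; these index the points of the set `A_j`, for `j ∈ {1,…,m+1}`. -/
def gapIdx (n m : ℕ) (ι : Fin m → Fin n) (j : ℕ) : Finset (Fin n) :=
  Finset.univ.filter (fun i =>
    posFun n m ι (j - 1) < (i : ℕ) + 1 ∧ (i : ℕ) + 1 < posFun n m ι j)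

theorem posFun_mono (n m : ℕ) (ι : Fin m → Fin n) (hι : StrictMono ι) :
    Monotone (posFun n m ι) := by
  intro a b hab
  unfold posFun
  split_ifs with h1 h2 h3 h4 <;> try omega
  have h : ι ⟨a - 1, by omega⟩ ≤ ι ⟨b - 1, by omega⟩ :=
    hι.monotone (Fin.mk_le_mk.2 (by omega))
  have h' : (ι ⟨a - 1, by omega⟩ : ℕ) ≤ (ι ⟨b - 1, by omega⟩ : ℕ) := h
  omega

/-- Marking one member below each odd gap of an increasing list makes the parity of
`α + #{marked elements ≥ α}` the same for every member `α` of the list. -/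
theorem exists_parity_correction (L : List ℕ) (hL : L.Pairwise (· < ·)) :
    ∃ (E : Finset ℕ) (c : ℕ),
      E.card ≤ ((L.zip L.tail).filter (fun p => (p.2 - p.1) % 2 = 1)).length ∧
      (∀ e ∈ E, e ∈ L ∧ ∃ b ∈ L, e < b) ∧
      ∀ α ∈ L, (α + (E.filter (α ≤ ·)).card) % 2 = c % 2 := by
  induction L with
  | nil => exact ⟨∅, 0, by simp⟩
  | cons a L ih =>
    rw [List.pairwise_cons] at hL
    obtain ⟨haL, hL⟩ := hL
    cases L with
    | nil => exact ⟨∅, a, by simp⟩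
    | cons b L =>
      obtain ⟨E, c, hcard, hE, hpar⟩ := ih hL
      have hab : a < b := haL b (by simp)
      have hbE : ∀ e ∈ E, b ≤ e := by
        intro e he
        rcases List.mem_cons.1 (hE e he).1 with h | h
        · omega
        · exact ((List.pairwise_cons.1 hL).1 e h).le
      have hEb : E.filter (b ≤ ·) = E := filter_true_of_mem hbE
      have hEa : E.filter (a ≤ ·) = E := filter_true_of_mem fun e he => hab.le.trans (hbE e he)
      have haE : a ∉ E := fun h => absurd (hbE a h) (by omega)
      have hb := hpar b (by simp)
      rw [hEb] at hb
      simp only [List.tail_cons] at hcard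
      by_cases hodd : (b - a) % 2 = 1
      · refine ⟨insert a E, c, ?_, ?_, ?_⟩
        · simp only [List.tail_cons, List.zip_cons_cons, List.filter_cons, hodd,
            decide_true, if_true, List.length_cons]
          rw [card_insert_of_notMem haE]
          omega
        · intro e he
          rcases mem_insert.1 he with rfl | he
          · exact ⟨by simp, b, by simp, hab⟩
          · obtain ⟨h1, b', h2, h3⟩ := hE e he
            exact ⟨List.mem_cons_of_mem _ h1, b', List.mem_cons_of_mem _ h2, h3⟩
        · intro α hα
          rcases List.mem_cons.1 hα with rfl | hα
          · rw [filter_insert, if_pos le_rfl, hEa, card_insert_of_notMem haE]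
            omega
          · rw [filter_insert, if_neg (not_le.2 (haL α hα))]
            exact hpar α hα
      · refine ⟨E, c, ?_, ?_, ?_⟩
        · simp only [List.tail_cons, List.zip_cons_cons, List.filter_cons, hodd,
            decide_false]
          simpa using hcard
        · intro e he
          obtain ⟨h1, b', h2, h3⟩ := hE e he
          exact ⟨List.mem_cons_of_mem _ h1, b', List.mem_cons_of_mem _ h2, h3⟩
        · intro α hα
          rcases List.mem_cons.1 hα with rfl | hα
          · rw [hEa]
            omega
          · exact hpar α hα

theorem neg_one_pow_mul_prod_sub_pos (F : Finset ℕ) (τ : ℕ → ℝ) (x : ℝ) (α : ℕ)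
    (hgt : ∀ j ∈ F, α ≤ j → x < τ j) (hlt : ∀ j ∈ F, j < α → τ j < x) :
    0 < (-1 : ℝ) ^ (F.filter (α ≤ ·)).card * ∏ j ∈ F, (x - τ j) := by
  rw [← prod_const, prod_filter, ← prod_mul_distrib]
  refine prod_pos fun j hj => ?_
  split_ifs with h
  · linarith [hgt j hj h]
  · linarith [hlt j hj (not_le.1 h)]

/-- A real polynomial of degree at most `d` is the pullback along the moment curve of an affine
functional on `ℝ^d`. -/
theorem exists_affineMap_momentCurve (d : ℕ) (q : Polynomial ℝ) (hq : q.natDegree ≤ d) :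
    ∃ f : Pt d →ᵃ[ℝ] ℝ, ∀ x, f (momentCurve d x) = q.eval x := by
  refine ⟨(∑ i : Fin d, q.coeff (i + 1) • LinearMap.proj (R := ℝ) (φ := fun _ => ℝ) i).toAffineMap
    + AffineMap.const ℝ (Pt d) (q.coeff 0), fun x => ?_⟩
  rw [Polynomial.eval_eq_sum_range' (Nat.lt_succ_of_le hq), sum_range_succ']
  simp [momentCurve, Finset.sum_range]

theorem momentCurve_injective {d : ℕ} (hd : 1 ≤ d) : Function.Injective (momentCurve d) := by
  intro x y h
  simpa [momentCurve] using congrFun h ⟨0, hd⟩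

theorem gapIdx_pairwiseDisjoint (n m : ℕ) (ι : Fin m → Fin n) (hι : StrictMono ι) :
    Pairwise (Function.onFun Disjoint (gapIdx n m ι)) := by
  have key : ∀ a b, a < b → Disjoint (gapIdx n m ι a) (gapIdx n m ι b) := by
    intro a b hab
    rw [disjoint_left]
    intro i hi hi'
    simp only [gapIdx, mem_filter, mem_univ, true_and] at hi hi'
    have := posFun_mono n m ι hι (show a ≤ b - 1 by omega)
    omega
  intro a b hab
  rcases lt_or_gt_of_ne hab with h | h
  · exact key a b h
  · exact (key b a h).symm

theorem disjoint_convexHull_affineSpan {E : Type*} [AddCommGroup E] [Module ℝ E]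
    (f : E →ᵃ[ℝ] ℝ) (Y T : Set E) (hY : ∀ y ∈ Y, 0 < f y) (hT : ∀ y ∈ T, f y = 0) :
    Disjoint (convexHull ℝ Y) (affineSpan ℝ T : Set E) := by
  rw [Set.disjoint_left]
  intro v hv hv'
  have h1 : convexHull ℝ Y ⊆ f ⁻¹' Set.Ioi 0 :=
    convexHull_min hY ((convex_Ioi (0 : ℝ)).affine_preimage f)
  have h2 : affineSpan ℝ T ≤ (affineSpan ℝ {(0 : ℝ)}).comap f :=
    affineSpan_le.2 fun y hy => by simp [hT y hy]
  have h3 : 0 < f v := h1 hv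
  have h4 : f v = 0 := by simpa using h2 hv'
  exact absurd h4 (ne_of_gt h3)

/-- The affine functional vanishing on the chosen points of the moment curve and positive on
the gaps indexed by `S`. -/
theorem exists_affineMap_pos_on_gaps (d m n : ℕ) (t : Fin n → ℝ) (ht : StrictMono t)
    (ι : Fin m → Fin n) (hι : StrictMono ι) (S : Finset ℕ) (hS : S ⊆ Icc 1 (m + 1))
    (hOD : m + OD S ≤ d) :
    ∃ f : Pt d →ᵃ[ℝ] ℝ, (∀ j, f (momentCurve d (t (ι j))) = 0) ∧
      ∀ α ∈ S, ∀ i ∈ gapIdx n m ι α, 0 < f (momentCurve d (t i)) := by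
  obtain ⟨E, c, hcard, hE, hpar⟩ :=
    exists_parity_correction (S.sort (· ≤ ·)) (sortedLT_sort S).pairwise
  simp only [mem_sort] at hE hpar
  have hEI : ∀ e ∈ E, 1 ≤ e ∧ e ≤ m := by
    intro e he
    obtain ⟨h1, b, h2, h3⟩ := hE e he
    have := mem_Icc.1 (hS h1)
    have := mem_Icc.1 (hS h2)
    omega
  let τ : ℕ → ℝ := fun j => if h : 1 ≤ j ∧ j ≤ m then t (ι ⟨j - 1, by omega⟩) else 0
  let q : Polynomial ℝ := Polynomial.C ((-1 : ℝ) ^ (m + 1 + c)) *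
    ((∏ j ∈ Icc 1 m, (Polynomial.X - Polynomial.C (τ j))) *
      ∏ j ∈ E, (Polynomial.X - Polynomial.C (τ j)))
  have hq : q.natDegree ≤ d := by
    refine (Polynomial.natDegree_C_mul_le _ _).trans ?_
    refine Polynomial.natDegree_mul_le.trans ?_
    rw [Polynomial.natDegree_finsetProd_X_sub_C_eq_card,
      Polynomial.natDegree_finsetProd_X_sub_C_eq_card, Nat.card_Icc]
    unfold OD at hOD
    omega
  obtain ⟨f, hf⟩ := exists_affineMap_momentCurve d q hq
  refine ⟨f, fun j => ?_, fun α hα i hi => ?_⟩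
  · have hj : (j : ℕ) + 1 ∈ Icc 1 m := mem_Icc.2 ⟨by omega, j.2⟩
    have hτ : τ (j + 1) = t (ι j) := by
      have h : 1 ≤ (j : ℕ) + 1 ∧ (j : ℕ) + 1 ≤ m := mem_Icc.1 hj
      simp [τ]
    rw [hf]
    simp only [q, Polynomial.eval_mul, Polynomial.eval_prod, Polynomial.eval_sub,
      Polynomial.eval_X, Polynomial.eval_C]
    rw [prod_eq_zero hj (by rw [hτ, sub_self])]
    ring
  · simp only [gapIdx, mem_filter, mem_univ, true_and] at hi
    have hαI := mem_Icc.1 (hS hα)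
    have hpos : ∀ j (h : 1 ≤ j ∧ j ≤ m),
        posFun n m ι j = (ι ⟨j - 1, by omega⟩ : ℕ) + 1 ∧
          τ j = t (ι ⟨j - 1, by omega⟩) := by
      intro j h
      simp only [posFun, τ, dif_pos h, and_self]
    have hgt : ∀ j, 1 ≤ j ∧ j ≤ m → α ≤ j → t i < τ j := by
      intro j hj hαj
      obtain ⟨h1, h2⟩ := hpos j hj
      have := posFun_mono n m ι hι hαj
      rw [h2]
      exact ht (Fin.lt_def.2 (by omega))
    have hlt : ∀ j, 1 ≤ j ∧ j ≤ m → j < α → τ j < t i := by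
      intro j hj hαj
      obtain ⟨h1, h2⟩ := hpos j hj
      have := posFun_mono n m ι hι (show j ≤ α - 1 by omega)
      rw [h2]
      exact ht (Fin.lt_def.2 (by omega))
    have p1 := neg_one_pow_mul_prod_sub_pos (Icc 1 m) τ (t i) α
      (fun j hj => hgt j (mem_Icc.1 hj)) (fun j hj => hlt j (mem_Icc.1 hj))
    have p2 := neg_one_pow_mul_prod_sub_pos E τ (t i) α
      (fun j hj => hgt j (hEI j hj)) (fun j hj => hlt j (hEI j hj))
    have hfil : (Icc 1 m).filter (α ≤ ·) = Icc α m := by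
      ext j
      simp only [mem_filter, mem_Icc]
      omega
    rw [hfil, Nat.card_Icc] at p1
    have hsign : (-1 : ℝ) ^ (m + 1 + c) =
        (-1) ^ (m + 1 - α) * (-1) ^ (E.filter (α ≤ ·)).card := by
      have := hpar α hα
      rw [← pow_add, neg_one_pow_eq_pow_mod_two,
        neg_one_pow_eq_pow_mod_two (n := m + 1 - α + _)]
      congr 1
      omega
    rw [hf]
    simp only [q, Polynomial.eval_mul, Polynomial.eval_prod, Polynomial.eval_sub,
      Polynomial.eval_X, Polynomial.eval_C]
    rw [hsign]
    linarith [mul_pos p1 p2]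

/-- with `v_i = γ(t_i)` (`t₁ < … < t_n`), `T = {v_{i₁},…,v_{i_{d-λ+1}}}`
and the gap sets `A₁, …, A_{d-λ+2}` as above, if `aff(T)` meets the convex hull of every
`k`-element subset of `V = {v₁,…,v_n}`, then `Σ_{α ∈ S} |A_α| ≤ k-1` for every
`S ⊆ {1,…,d-λ+2}` with `OD(S) ≤ λ-1`. -/
theorem gap_count_bound (k d lam n : ℕ) (hk : 1 ≤ k) (hlam : 1 ≤ lam) (hdl : lam ≤ d)
    (t : Fin n → ℝ) (ht : StrictMono t)
    (ι : Fin (d - lam + 1) → Fin n) (hι : StrictMono ι)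
    (htrans : ∀ Y : Finset (Pt d), Y ⊆ cyclicVerts d n t → Y.card = k →
      ((convexHull ℝ (Y : Set (Pt d))) ∩
        ((affineSpan ℝ
            ((Finset.univ.image (fun j => momentCurve d (t (ι j)))) : Set (Pt d)) :
          AffineSubspace ℝ (Pt d)) : Set (Pt d))).Nonempty) :
    ∀ S : Finset ℕ, S ⊆ Finset.Icc 1 (d - lam + 2) → OD S ≤ lam - 1 →
      (∑ a ∈ S,
        ((gapIdx n (d - lam + 1) ι a).image (fun i => momentCurve d (t i))).card)
        ≤ k - 1 := by
  intro S hS hOD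
  by_contra! hlt
  obtain ⟨f, hf0, hfpos⟩ := exists_affineMap_pos_on_gaps d (d - lam + 1) n t ht ι hι S hS
    (by omega)
  have hinj : Function.Injective fun i => momentCurve d (t i) :=
    (momentCurve_injective (hlam.trans hdl)).comp ht.injective
  simp only [card_image_of_injective _ hinj] at hlt
  rw [← card_biUnion fun a _ b _ hab => gapIdx_pairwiseDisjoint n _ ι hι hab,
    ← card_image_of_injective _ hinj] at hlt
  obtain ⟨Y, hYsub, hYcard⟩ := exists_subset_card_eq (Nat.le_of_pred_lt hlt)
  obtain ⟨v, hv, hv'⟩ := htrans Y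
    (hYsub.trans (image_subset_image (subset_univ _))) hYcard
  refine Set.disjoint_left.1 (disjoint_convexHull_affineSpan f _ _ ?_ ?_) hv hv'
  · intro y hy
    obtain ⟨i, hi, rfl⟩ := mem_image.1 (hYsub hy)
    obtain ⟨α, hα, hiα⟩ := mem_biUnion.1 hi
    exact hfpos α hα i hiα
  · intro y hy
    obtain ⟨j, -, rfl⟩ := mem_image.1 (mem_coe.1 hy)
    exact hf0 j
end
end
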